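/- arXiv:2511.11657 — 2 statements merged into one kernel-verified Lean document; each statement's English description precedes it below -/
import Mathlib

section
/- Exact ceiling formula for the n-th lucky number: let n ≥ 2 and let β = L(n), so that l_β is the largest lucky number (with the convention l₁ = 2) that is ≤ n. Define m₀ = n and m_{j+1} = ⌈m_j·l_{β−j}/(l_{β−j} − 1) − 1⌉ for 0 ≤ j ≤ β − 1. Then m_β = l_n. -/
open scoped BigOperators

namespace LuckyPaper

/-- Rank of `k` in `A`: the number of elements of `A` that are `≤ k`
(the 1-indexed position of `k` in `A` when `k ∈ A`). -/
noncomputable def rank (A : Set ℕ) (k : ℕ) : ℕ := Set.ncard {m | m ∈ A ∧ m ≤ k}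

/-- One sieve step: delete every `d`-th element of `A` (listed in increasing order). -/
noncomputable def step (A : Set ℕ) (d : ℕ) : Set ℕ := {k | k ∈ A ∧ ¬ d ∣ rank A k}

/-- The lucky sieve: `sieve i = (A_i, l_i)`, where `A_0 = {1,2,3,…}`, `l_0 = 1` (dummy),
`l_{i+1}` is the smallest element of `A_i` larger than `l_i`, and `A_{i+1}` is obtained
from `A_i` by deleting every `l_{i+1}`-th element.  In particular `l_1 = 2`. -/
noncomputable def sieve : ℕ → Set ℕ × ℕ
  | 0 => ({n | 1 ≤ n}, 1)
  | i + 1 =>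
      let p := sieve i
      let d := sInf {m | m ∈ p.1 ∧ p.2 < m}
      (step p.1 d, d)

/-- `A i` : the set of survivors after `i` steps of the lucky sieve. -/
noncomputable def A (i : ℕ) : Set ℕ := (sieve i).1

/-- `l i` : the `i`-th sieve parameter (`l 1 = 2`, `l 2 = 3`, `l 3 = 7`, `l 4 = 9`, …);
with this convention `l n` is the `n`-th lucky number for `n ≥ 2`. -/
noncomputable def l (i : ℕ) : ℕ := (sieve i).2

/-- The set of lucky numbers `A_∞ = ⋂ i, A i = {1, 3, 7, 9, 13, 15, 21, 25, …}`. -/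
noncomputable def LuckySet : Set ℕ := ⋂ i, A i

/-- `L x` : the number of lucky numbers that are `≤ x`. -/
noncomputable def L (x : ℝ) : ℕ := Set.ncard {m | m ∈ LuckySet ∧ (m : ℝ) ≤ x}

/-- `R i x = #{k ∈ A_{i-1} : k ≤ x}`. -/
noncomputable def R (i : ℕ) (x : ℝ) : ℕ := Set.ncard {m | m ∈ A (i - 1) ∧ (m : ℝ) ≤ x}

/-- `𝕃 = {l 1, l 2, l 3, …} = {2, 3, 7, 9, 13, …}`. -/
noncomputable def Ell : Set ℕ := {a | ∃ i, 1 ≤ i ∧ l i = a}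

/-- `starIdx i m` : the `m`-th number deleted at step `i` of the sieve, i.e. the
`(l i * m)`-th smallest element of `A (i-1)` (`Nat.nth` is 0-indexed). -/
noncomputable def starIdx (i m : ℕ) : ℕ := Nat.nth (· ∈ A (i - 1)) (l i * m - 1)

/-- The binary operation `*` : for `a ∈ 𝕃`, `star a m = a * m` is the `m`-th number
deleted at the (unique) step `i ≥ 1` with `l i = a`. -/
noncomputable def star (a m : ℕ) : ℕ := starIdx (sInf {i | 1 ≤ i ∧ l i = a}) m

/-- `evalStar [a₁, …, a_k] = a₁ * (a₂ * (⋯ * a_k)⋯)`. -/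
noncomputable def evalStar : List ℕ → ℕ
  | [] => 1
  | [a] => a
  | a :: b :: rest => star a (evalStar (b :: rest))

/-- `t = (a₁, …, a_k)` is a lucky factorization of `n` : `k ≥ 1`, `a_j ∈ 𝕃` for `j < k`,
`a_k` is a lucky number (possibly 1), and `n = a₁*(a₂*(⋯*a_k)⋯)`. -/
def IsLuckyFactorization (n : ℕ) (t : List ℕ) : Prop :=
  t ≠ [] ∧ (∀ a ∈ t.dropLast, a ∈ Ell) ∧ t.getLast! ∈ LuckySet ∧ evalStar t = n

/-- The canonical tuple of `n` given by the fundamental theorem of arithmetic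
for lucky numbers. -/
noncomputable def canonicalTuple (n : ℕ) : List ℕ :=
  haveI := Classical.propDecidable (∃ t, IsLuckyFactorization n t)
  if h : ∃ t, IsLuckyFactorization n t then h.choose else []

/-- `Ω°(n)` : the length of the canonical tuple of `n`. -/
noncomputable def bigOmega (n : ℕ) : ℕ := (canonicalTuple n).length

/-- `ω°(n)` : the number of distinct entries of the canonical tuple of `n`. -/
noncomputable def smallOmega (n : ℕ) : ℕ := (canonicalTuple n).dedup.length

/-- `d°(n)` : the number of distinct nonempty contiguous subtuples (infixes) of the
canonical tuple of `n`. -/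
noncomputable def dCirc (n : ℕ) : ℕ :=
  Set.ncard {s : List ℕ | s ≠ [] ∧ s <:+: canonicalTuple n}

/-- `B` : positive integers whose canonical tuple has last entry `≠ 1`. -/
noncomputable def Bset : Set ℕ := {n | 1 ≤ n ∧ (canonicalTuple n).getLast! ≠ 1}

/-- `C` : positive integers whose canonical tuple ends with the pair `(2, 1)`. -/
noncomputable def Cset : Set ℕ := {n | 1 ≤ n ∧ ∃ t, canonicalTuple n = t ++ [2, 1]}

/-- `S = B ∪ C`. -/
noncomputable def Sset : Set ℕ := Bset ∪ Cset

/-- The `𝕃`-tuple of `a ∈ S` : the canonical tuple of `a` if it does not end in `1`,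
else the canonical tuple with the final `1` removed (so it ends in `2`). -/
noncomputable def ellTuple (a : ℕ) : List ℕ :=
  if (canonicalTuple a).getLast! = 1 then (canonicalTuple a).dropLast else canonicalTuple a

/-- The extended operation `∘` : if the `𝕃`-tuple of `a` is `(t₁, …, t_k)`, then
`a ∘ b = t₁*(t₂*(⋯*(t_k*b)⋯))`. -/
noncomputable def circ (a b : ℕ) : ℕ := (ellTuple a).foldr star b


theorem finite_sep_le (A : Set ℕ) (k : ℕ) : {m | m ∈ A ∧ m ≤ k}.Finite :=
  (Set.finite_Iic k).subset fun _ hm => hm.2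

theorem rank_succ_of_mem {A : Set ℕ} {k : ℕ} (h : k + 1 ∈ A) :
    rank A (k + 1) = rank A k + 1 := by
  have hset : {m | m ∈ A ∧ m ≤ k + 1} = insert (k + 1) {m | m ∈ A ∧ m ≤ k} := by
    ext m
    simp only [Set.mem_ofPred_eq, Set.mem_insert_iff]
    grind
  rw [rank, hset, Set.ncard_insert_of_notMem (by simp) (finite_sep_le A k), rank]

theorem rank_succ_of_notMem {A : Set ℕ} {k : ℕ} (h : k + 1 ∉ A) :
    rank A (k + 1) = rank A k := by
  have hset : {m | m ∈ A ∧ m ≤ k + 1} = {m | m ∈ A ∧ m ≤ k} := by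
    ext m
    simp only [Set.mem_ofPred_eq]
    grind
  rw [rank, hset, rank]

theorem rank_zero {A : Set ℕ} (h : 0 ∉ A) : rank A 0 = 0 := by
  have hset : {m | m ∈ A ∧ m ≤ 0} = ∅ := by
    ext m
    simp only [Set.mem_ofPred_eq, Set.mem_empty_iff_false]
    grind
  rw [rank, hset, Set.ncard_empty]

/-- Among the first `r` elements of `A`, one sieve step with parameter `d` deletes `r / d`. -/
theorem rank_step_add {A : Set ℕ} (h0 : 0 ∉ A) (d x : ℕ) :
    rank (step A d) x + rank A x / d = rank A x := by
  induction x with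
  | zero => simp [rank_zero h0, rank_zero (A := step A d) fun h => h0 h.1]
  | succ x ih =>
    by_cases hx : x + 1 ∈ A
    · have hr := rank_succ_of_mem hx
      by_cases hd : d ∣ rank A (x + 1)
      · rw [rank_succ_of_notMem (A := step A d) fun h => h.2 hd]
        rw [hr] at hd ⊢
        rw [Nat.succ_div, if_pos hd]
        omega
      · rw [rank_succ_of_mem (A := step A d) ⟨hx, hd⟩]
        rw [hr] at hd ⊢
        rw [Nat.succ_div, if_neg hd]
        omega
    · rwa [rank_succ_of_notMem hx, rank_succ_of_notMem (A := step A d) fun h => hx h.1]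

theorem rank_eq_of_gap {A : Set ℕ} {a b : ℕ} (hab : a ≤ b)
    (h : ∀ m ∈ A, a < m → b < m) : rank A b = rank A a := by
  have hset : {m | m ∈ A ∧ m ≤ b} = {m | m ∈ A ∧ m ≤ a} := by
    ext m
    simp only [Set.mem_ofPred_eq]
    grind
  rw [rank, hset, rank]

theorem sInf_gt_mem {A : Set ℕ} (hA : A.Infinite) (a : ℕ) :
    sInf {m | m ∈ A ∧ a < m} ∈ A ∧ a < sInf {m | m ∈ A ∧ a < m} :=
  Nat.sInf_mem (s := {m | m ∈ A ∧ a < m}) (hA.exists_gt a)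

/-- The successor of `a` in `A` has rank one more than `a`. -/
theorem rank_sInf_gt {A : Set ℕ} (hA : A.Infinite) (a : ℕ) :
    rank A (sInf {m | m ∈ A ∧ a < m}) = rank A a + 1 := by
  obtain ⟨hmem, hlt⟩ := sInf_gt_mem hA a
  have hmin : ∀ m ∈ A, a < m → sInf {m | m ∈ A ∧ a < m} ≤ m :=
    fun m hm ham => Nat.sInf_le ⟨hm, ham⟩
  generalize sInf {m | m ∈ A ∧ a < m} = b at *
  obtain ⟨b, rfl⟩ : ∃ c, b = c + 1 := ⟨b - 1, by omega⟩
  rw [rank_succ_of_mem hmem, rank_eq_of_gap (by omega : a ≤ b)]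
  exact fun m hm ham => hmin m hm ham

theorem step_infinite {A : Set ℕ} (hA : A.Infinite) {d : ℕ} (hd : 2 ≤ d) :
    (step A d).Infinite := by
  refine Set.infinite_of_forall_exists_gt fun a => ?_
  obtain ⟨hx, hax⟩ := sInf_gt_mem hA a
  generalize sInf {m | m ∈ A ∧ a < m} = x at *
  obtain ⟨hy, hxy⟩ := sInf_gt_mem hA x
  have hr := rank_sInf_gt hA x
  generalize sInf {m | m ∈ A ∧ x < m} = y at *
  by_cases h : d ∣ rank A x
  · refine ⟨y, ⟨hy, fun h' => ?_⟩, hax.trans hxy⟩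
    rw [hr, ← Nat.dvd_add_iff_right h, Nat.dvd_one] at h'
    omega
  · exact ⟨x, ⟨hx, h⟩, hax⟩

theorem mem_A_zero {x : ℕ} : x ∈ A 0 ↔ 1 ≤ x := Iff.rfl

theorem l_zero : l 0 = 1 := rfl

theorem A_infinite_and_one_le_l (i : ℕ) : (A i).Infinite ∧ 1 ≤ l i := by
  induction i with
  | zero => exact ⟨Set.infinite_of_forall_exists_gt fun a => ⟨a + 1, by simp [mem_A_zero]⟩, le_rfl⟩
  | succ i ih =>
    have hlt : l i < l (i + 1) := (sInf_gt_mem ih.1 (l i)).2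
    exact ⟨step_infinite ih.1 (d := l (i + 1)) (by omega), by omega⟩

theorem A_infinite (i : ℕ) : (A i).Infinite := (A_infinite_and_one_le_l i).1

theorem l_strictMono : StrictMono l :=
  strictMono_nat_of_lt_succ fun i => (sInf_gt_mem (A_infinite i) (l i)).2

theorem l_succ_mem (i : ℕ) : l (i + 1) ∈ A i := (sInf_gt_mem (A_infinite i) (l i)).1

theorem lt_l (i : ℕ) : i < l i := by
  induction i with
  | zero => simp [l_zero]
  | succ i ih =>
    have := l_strictMono (lt_add_one i)
    omega

theorem A_antitone : Antitone A := antitone_nat_of_succ_le fun _ _ h => h.1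

theorem zero_notMem_A (i : ℕ) : 0 ∉ A i := fun h => by
  have := A_antitone (Nat.zero_le i) h
  simp [mem_A_zero] at this

theorem not_dvd_rank_A {i x : ℕ} (hx : x ∈ A (i + 1)) : ¬ l (i + 1) ∣ rank (A i) x := hx.2

theorem rank_A_succ_add (i x : ℕ) :
    rank (A (i + 1)) x + rank (A i) x / l (i + 1) = rank (A i) x :=
  rank_step_add (zero_notMem_A i) _ _

theorem rank_A_zero (x : ℕ) : rank (A 0) x = x := by
  induction x with
  | zero => exact rank_zero (zero_notMem_A 0)
  | succ x ih => rw [rank_succ_of_mem (by simp [mem_A_zero]), ih]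

theorem rank_A_succ_l_succ (i : ℕ) : rank (A (i + 1)) (l (i + 1)) = i + 1 := by
  induction i with
  | zero =>
    have hl : l 1 = 2 := by
      have h := rank_sInf_gt (A_infinite 0) (l 0)
      rwa [rank_A_zero, rank_A_zero] at h
    have h := rank_A_succ_add 0 (l 1)
    rw [rank_A_zero, zero_add, hl] at h
    rw [zero_add, hl]
    omega
  | succ i ih =>
    have h := rank_A_succ_add (i + 1) (l (i + 2))
    have hr : rank (A (i + 1)) (l (i + 2)) = rank (A (i + 1)) (l (i + 1)) + 1 :=
      rank_sInf_gt (A_infinite (i + 1)) (l (i + 1))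
    rw [hr, ih, Nat.div_eq_of_lt (lt_l (i + 2))] at h
    exact h

/-- An element whose rank is positive and smaller than the next sieve parameter survives all later
steps, with the same rank. -/
theorem mem_A_and_rank_eq {x i r : ℕ} (hx : x ∈ A i) (hr : rank (A i) x = r) (hpos : 0 < r)
    (hlt : r < l (i + 1)) {j : ℕ} (hij : i ≤ j) : x ∈ A j ∧ rank (A j) x = r := by
  induction j, hij using Nat.le_induction with
  | base => exact ⟨hx, hr⟩
  | succ j hij ih =>
    have hlj : r < l (j + 1) := hlt.trans_le (l_strictMono.monotone (by omega))
    have h := rank_A_succ_add j x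
    rw [ih.2, Nat.div_eq_of_lt hlj] at h
    refine ⟨⟨ih.1, fun hd => ?_⟩, h⟩
    change l (j + 1) ∣ rank (A j) x at hd
    rw [ih.2] at hd
    exact absurd (Nat.le_of_dvd hpos hd) (by omega)

theorem mem_LuckySet_of_rank {x i r : ℕ} (hx : x ∈ A i) (hr : rank (A i) x = r) (hpos : 0 < r)
    (hlt : r < l (i + 1)) : x ∈ LuckySet := by
  refine Set.mem_iInter.2 fun j => ?_
  rcases le_total i j with h | h
  · exact (mem_A_and_rank_eq hx hr hpos hlt h).1
  · exact A_antitone h hx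

theorem one_mem_LuckySet : 1 ∈ LuckySet :=
  mem_LuckySet_of_rank (i := 0) (mem_A_zero.2 le_rfl) (rank_A_zero 1) one_pos (lt_l 1)

theorem rank_A_l_add_two (i : ℕ) : rank (A (i + 1)) (l (i + 2)) = i + 2 := by
  have hr : rank (A (i + 1)) (l (i + 2)) = rank (A (i + 1)) (l (i + 1)) + 1 :=
    rank_sInf_gt (A_infinite (i + 1)) (l (i + 1))
  rw [hr, rank_A_succ_l_succ]

theorem l_add_two_mem_LuckySet (i : ℕ) : l (i + 2) ∈ LuckySet :=
  mem_LuckySet_of_rank (l_succ_mem (i + 1)) (rank_A_l_add_two i) (by omega) (lt_l (i + 2))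

theorem lt_l_L_add_one {n : ℕ} (hn : 1 ≤ n) : n < l (L (n : ℝ) + 1) := by
  have hL : L (n : ℝ) = rank LuckySet n := by simp [L, rank]
  rw [hL]
  by_contra! hle
  let f : ℕ → ℕ := fun i => if i = 0 then 1 else l (i + 1)
  have hinj : Set.InjOn f (Finset.range (rank LuckySet n + 1)) := by
    have h1 : ∀ i, l (i + 1) ≠ 1 := fun i => by have := lt_l (i + 1); omega
    intro a _ b _ hab
    by_cases ha : a = 0 <;> by_cases hb : b = 0
    · omega
    · simp only [f, ha, hb, if_true, if_false] at hab
      exact absurd hab.symm (h1 b)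
    · simp only [f, ha, hb, if_true, if_false] at hab
      exact absurd hab (h1 a)
    · simp only [f, ha, hb, if_false] at hab
      have := l_strictMono.injective hab
      omega
  have hmem : (f '' (Finset.range (rank LuckySet n + 1) : Set ℕ)) ⊆
      {m | m ∈ LuckySet ∧ m ≤ n} := by
    rintro _ ⟨i, hi, rfl⟩
    simp only [Finset.coe_range, Set.mem_Iio] at hi
    rcases i with _ | i
    · exact ⟨one_mem_LuckySet, hn⟩
    · exact ⟨l_add_two_mem_LuckySet i, (l_strictMono.monotone (by omega)).trans hle⟩
  have hcard := Set.ncard_le_ncard hmem (finite_sep_le LuckySet n)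
  rw [hinj.ncard_image, Set.ncard_coe_finset, Finset.card_range] at hcard
  change _ ≤ rank LuckySet n at hcard
  omega

/-- A survivor of step `i + 1` whose new rank is below the sieve parameter kept its rank. -/
theorem rank_A_eq_of_rank_A_succ_lt {i x : ℕ} (hx : x ∈ A (i + 1))
    (hlt : rank (A (i + 1)) x < l (i + 1)) : rank (A i) x = rank (A (i + 1)) x := by
  have h := rank_A_succ_add i x
  have hd := not_dvd_rank_A hx
  have hl := lt_l (i + 1)
  suffices rank (A i) x < l (i + 1) by
    rw [Nat.div_eq_of_lt this] at h
    omega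
  generalize rank (A (i + 1)) x = s at *
  generalize rank (A i) x = r at *
  generalize l (i + 1) = d at *
  by_contra! hdr
  have hmod : 0 < r % d := Nat.pos_of_ne_zero fun h0 => hd (Nat.dvd_of_mod_eq_zero h0)
  have hq : 1 ≤ r / d := (Nat.one_le_div_iff (by omega)).2 hdr
  have hdm := Nat.div_add_mod r d
  nlinarith

theorem rank_A_l_eq {n : ℕ} (hn : 2 ≤ n) {i : ℕ} (hi : n < l (i + 1)) :
    rank (A i) (l n) = n := by
  obtain ⟨n, rfl⟩ : ∃ k, n = k + 2 := ⟨n - 2, by omega⟩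
  have hbig : ∀ j, n + 1 ≤ j → rank (A j) (l (n + 2)) = n + 2 := fun j hj =>
    (mem_A_and_rank_eq (l_succ_mem (n + 1)) (rank_A_l_add_two n) (by omega) (lt_l (n + 2)) hj).2
  rcases le_total (n + 1) i with h | h
  · exact hbig i h
  · induction h using Nat.decreasingInduction with
    | self => exact hbig _ le_rfl
    | of_succ k hk ih =>
      have hr := ih (hi.trans (l_strictMono (by omega)))
      rw [rank_A_eq_of_rank_A_succ_lt (Set.mem_iInter.1 (l_add_two_mem_LuckySet n) _)
        (by omega), hr]

theorem ceil_mul_div_sub_one {d r s : ℕ} (hd : 2 ≤ d) (hdvd : ¬ d ∣ r) (h : s + r / d = r) :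
    ⌈(s : ℝ) * (d : ℝ) / ((d : ℝ) - 1) - 1⌉ = (r : ℤ) := by
  have hmod : 1 ≤ r % d := Nat.pos_of_ne_zero fun h0 => hdvd (Nat.dvd_of_mod_eq_zero h0)
  have hlt : r % d + 1 ≤ d := Nat.mod_lt r (by omega)
  have hdm := Nat.div_add_mod r d
  generalize r / d = q at *
  generalize r % d = t at *
  have hs : (s : ℝ) = r - q := by rw [← h]; push_cast; ring
  have hr : (r : ℝ) = d * q + t := by rw [← hdm]; push_cast; ring
  have hd' : (2 : ℝ) ≤ d := by exact_mod_cast hd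
  have ht : (1 : ℝ) ≤ t := by exact_mod_cast hmod
  have ht' : (t : ℝ) + 1 ≤ d := by exact_mod_cast hlt
  have hpos : (0 : ℝ) < d - 1 := by linarith
  have key : (s : ℝ) * d / (d - 1) - 1 = r + (t / (d - 1) - 1) := by
    rw [hs, hr]
    field_simp
    ring
  have h0 : (0 : ℝ) < t / (d - 1) := by positivity
  have h1 : (t : ℝ) / (d - 1) ≤ 1 := (div_le_one hpos).2 (by linarith)
  rw [Int.ceil_eq_iff, key, Int.cast_natCast]
  constructor <;> linarith

/-- exact ceiling formula for the `n`-th lucky number: let `n ≥ 2`,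
`β = L(n)`, `m₀ = n` and `m_{j+1} = ⌈m_j·l_{β−j}/(l_{β−j} − 1) − 1⌉` for
`0 ≤ j ≤ β − 1`.  Then `m_β = l_n`. -/
theorem nth_lucky_ceiling_formula (n : ℕ) (hn : 2 ≤ n) (β : ℕ) (hβ : β = L (n : ℝ))
    (m : ℕ → ℕ) (hm0 : m 0 = n)
    (hrec : ∀ j, j < β →
      (m (j + 1) : ℤ) =
        ⌈(m j : ℝ) * (l (β - j) : ℝ) / ((l (β - j) : ℝ) - 1) - 1⌉) :
    m β = l n := by
  have hx : ∀ i, l n ∈ A i := by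
    obtain ⟨k, rfl⟩ : ∃ k, n = k + 2 := ⟨n - 2, by omega⟩
    exact Set.mem_iInter.1 (l_add_two_mem_LuckySet k)
  have hm : ∀ j, j ≤ β → m j = rank (A (β - j)) (l n) := by
    intro j
    induction j with
    | zero =>
      intro _
      rw [hm0, Nat.sub_zero, rank_A_l_eq hn (hβ ▸ lt_l_L_add_one (by omega))]
    | succ j ih =>
      intro hj
      have hstep := hrec j hj
      obtain ⟨i, hi⟩ : ∃ i, β - j = i + 1 := ⟨β - j - 1, by omega⟩
      have hl := lt_l (i + 1)
      rw [ih (by omega), hi, ceil_mul_div_sub_one (by omega) (not_dvd_rank_A (hx (i + 1)))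
        (rank_A_succ_add i (l n))] at hstep
      rw [show β - (j + 1) = i by omega]
      exact_mod_cast hstep
  rw [hm β le_rfl, Nat.sub_self, rank_A_zero]

end LuckyPaper
end

section
/- There exists a constant C > 0 such that for all real x ≥ 2, the sum of Ω°(n) over all positive integers n ≤ x satisfies Σ_{n ≤ x} Ω°(n) ≤ C·x·log x. -/
open scoped BigOperators

namespace LuckyPaper

theorem rank_nth {S : Set ℕ} (hS : S.Infinite) (n : ℕ) :
    rank S (Nat.nth (· ∈ S) n) = n + 1 := by
  classical
  have h : {m | m ∈ S ∧ m ≤ Nat.nth (· ∈ S) n} =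
      (((Finset.range (Nat.nth (· ∈ S) n + 1)).filter (· ∈ S) : Finset ℕ) : Set ℕ) := by
    ext m
    simp [and_comm]
  rw [rank, h, Set.ncard_coe_finset, ← Nat.count_eq_card_filter_range]
  exact Nat.count_nth_succ_of_infinite (p := (· ∈ S)) hS n

theorem infinite_step {S : Set ℕ} (hS : S.Infinite) {d : ℕ} (hd : 2 ≤ d) :
    (step S d).Infinite := by
  refine Set.infinite_of_injective_forall_mem (f := fun k => Nat.nth (· ∈ S) (d * k)) ?_ ?_
  · intro a b hab
    exact Nat.eq_of_mul_eq_mul_left (by omega) (Nat.nth_injective hS hab)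
  · intro k
    refine ⟨Nat.nth_mem_of_infinite hS _, ?_⟩
    rw [rank_nth hS, Nat.dvd_add_right (dvd_mul_right d k), Nat.dvd_one]
    omega

theorem lt_sInf_of_infinite {S : Set ℕ} (hS : S.Infinite) (b : ℕ) :
    b < sInf {m | m ∈ S ∧ b < m} := by
  obtain ⟨m, hm, hbm⟩ := hS.exists_gt b
  exact (Nat.sInf_mem (s := {m | m ∈ S ∧ b < m}) ⟨m, hm, hbm⟩).2

theorem sieve_spec (i : ℕ) : (A i).Infinite ∧ i + 1 ≤ l i ∧ ∀ m ∈ A i, 1 ≤ m := by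
  induction i with
  | zero => exact ⟨Set.Ici_infinite 1, le_rfl, fun m hm => hm⟩
  | succ i ih =>
    obtain ⟨hA, hl, hpos⟩ := ih
    have hlt : l i < l (i + 1) := lt_sInf_of_infinite hA (l i)
    exact ⟨infinite_step hA (show 2 ≤ l (i + 1) by omega), by omega,
      fun m hm => hpos m hm.1⟩

theorem succ_le_nth {S : Set ℕ} (hS : S.Infinite) (hpos : ∀ m ∈ S, 1 ≤ m) (n : ℕ) :
    n + 1 ≤ Nat.nth (· ∈ S) n := by
  induction n with
  | zero => exact hpos _ (Nat.nth_mem_of_infinite hS 0)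
  | succ n ih =>
    have : Nat.nth (· ∈ S) n < Nat.nth (· ∈ S) (n + 1) :=
      Nat.nth_strictMono hS (Nat.lt_succ_self n)
    omega

theorem mul_le_starIdx (i m : ℕ) : l i * m ≤ starIdx i m := by
  obtain ⟨hA, -, hpos⟩ := sieve_spec (i - 1)
  have := succ_le_nth hA hpos (l i * m - 1)
  unfold starIdx
  omega

theorem two_mul_le_star {a : ℕ} (ha : a ∈ Ell) (m : ℕ) : 2 * m ≤ star a m := by
  have hi := (Nat.sInf_mem (s := {i | 1 ≤ i ∧ l i = a}) ha).1
  have hl := (sieve_spec (sInf {i | 1 ≤ i ∧ l i = a})).2.1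
  exact (Nat.mul_le_mul_right m (by omega)).trans (mul_le_starIdx _ m)

theorem two_pow_length_le_evalStar (t : List ℕ) (hne : t ≠ [])
    (hEll : ∀ a ∈ t.dropLast, a ∈ Ell) (hlast : t.getLast! ∈ LuckySet) :
    2 ^ t.length ≤ 2 * evalStar t := by
  induction t with
  | nil => exact absurd rfl hne
  | cons a t ih =>
    cases t with
    | nil =>
      have ha : 1 ≤ a := (sieve_spec 0).2.2 a (Set.mem_iInter.mp hlast 0)
      simp only [List.length_singleton, evalStar]
      omega
    | cons b t =>
      have ht := ih (by simp) (fun c hc => hEll c (by simp [hc]))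
        (by simpa [List.getLast!_eq_getLast?_getD] using hlast)
      have hstar := two_mul_le_star (hEll a (by simp)) (evalStar (b :: t))
      rw [List.length_cons, pow_succ]
      change _ ≤ 2 * star a (evalStar (b :: t))
      omega

theorem two_pow_bigOmega_le {n : ℕ} (hn : 1 ≤ n) : 2 ^ bigOmega n ≤ 2 * n := by
  unfold bigOmega canonicalTuple
  split_ifs with h
  · obtain ⟨hne, hEll, hlast, heval⟩ := h.choose_spec
    exact (two_pow_length_le_evalStar _ hne hEll hlast).trans_eq (by rw [heval])
  · simp only [List.length_nil, pow_zero]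
    omega

/-- there exists a constant `C > 0` such that for all real `x ≥ 2`,
`Σ_{n ≤ x} Ω°(n) ≤ C·x·log x`. -/
theorem sum_bigOmega_le :
    ∃ C : ℝ, 0 < C ∧ ∀ x : ℝ, 2 ≤ x →
      (∑ n ∈ Finset.Icc 1 ⌊x⌋₊, (bigOmega n : ℝ)) ≤ C * x * Real.log x := by
  have hlog2 : 0 < Real.log 2 := Real.log_pos one_lt_two
  refine ⟨2 / Real.log 2, by positivity, fun x hx => ?_⟩
  have hlogx : Real.log 2 ≤ Real.log x := Real.log_le_log two_pos hx
  have hterm : ∀ n ∈ Finset.Icc 1 ⌊x⌋₊, (bigOmega n : ℝ) ≤ 2 / Real.log 2 * Real.log x := by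
    intro n hn
    obtain ⟨hn1, hnx⟩ := Finset.mem_Icc.mp hn
    have hnx' : (n : ℝ) ≤ x := (Nat.le_floor_iff (by linarith)).mp hnx
    have hpow : (2 : ℝ) ^ bigOmega n ≤ 2 * x :=
      le_trans (by exact_mod_cast two_pow_bigOmega_le hn1)
        (mul_le_mul_of_nonneg_left hnx' zero_le_two)
    have hlog := Real.log_le_log (by positivity) hpow
    rw [Real.log_pow, Real.log_mul two_ne_zero (by linarith)] at hlog
    rw [div_mul_eq_mul_div, le_div_iff₀ hlog2]
    linarith
  calc (∑ n ∈ Finset.Icc 1 ⌊x⌋₊, (bigOmega n : ℝ))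
      ≤ (Finset.Icc 1 ⌊x⌋₊).card • (2 / Real.log 2 * Real.log x) :=
        Finset.sum_le_card_nsmul _ _ _ hterm
    _ = ⌊x⌋₊ * (2 / Real.log 2 * Real.log x) := by simp
    _ ≤ x * (2 / Real.log 2 * Real.log x) :=
        mul_le_mul_of_nonneg_right (Nat.floor_le (by linarith))
          (mul_nonneg (by positivity) (hlog2.le.trans hlogx))
    _ = 2 / Real.log 2 * x * Real.log x := by ring

end LuckyPaper
end
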